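/- Let F be a field and D a subring of F. For each projective model X of F/D, the mapping d_X : Zar_F(D) → X that sends a valuation ring V ∈ Zar_F(D) to the unique local ring in X that V dominates is surjective, and it is continuous and closed with respect to both the Zariski topologies and the patch topologies on Zar_F(D) and X. -/

import Mathlib

/-!
Common definitions: valuation rings of a field, the Zariski--Riemann space
`Zar_F(D)` with its Zariski and patch topologies, domination of local subrings,
residual algebraicity, integral closedness, and projective models of `F/D`.
-/

variable {F : Type*} [Field F]

/-- `x` lies in the maximal ideal (set of nonunits) of the (local) subring `R` of `F`. -/
def MemMaxIdeal (R : Subring F) (x : F) : Prop :=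
  ∃ h : x ∈ R, ¬ IsUnit (⟨x, h⟩ : R)

/-- The local ring `R` dominates the local ring `S` (both subrings of `F`):
`S ⊆ R` and the maximal ideal of `R` contracts to the maximal ideal of `S`. -/
def Dominates (R S : Subring F) : Prop :=
  S ≤ R ∧ ∀ x ∈ S, (MemMaxIdeal S x ↔ MemMaxIdeal R x)

/-- `V` is a valuation ring of the field `F`: for every nonzero `x ∈ F`,
`x ∈ V` or `x⁻¹ ∈ V`. -/
def IsValSubring (V : Subring F) : Prop :=
  ∀ x : F, x ≠ 0 → x ∈ V ∨ x⁻¹ ∈ V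

/-- `Zar_F(D)`: the valuation rings of `F` containing `D`. -/
def zarSet (D : Subring F) : Set (Subring F) :=
  {V | IsValSubring V ∧ D ≤ V}

/-- `Dom_F(D)`: the valuation rings of `F` dominating the local subring `D`. -/
def domSet (D : Subring F) : Set (Subring F) :=
  {V | IsValSubring V ∧ Dominates V D}

/-- The Zariski topology on a collection `X` of subrings of `F`, with basic open sets
`U(x₁,…,xₙ) = {R ∈ X : x₁,…,xₙ ∈ R}`. -/
def zariskiTop (X : Set (Subring F)) : TopologicalSpace X :=
  TopologicalSpace.generateFrom
    {U | ∃ s : Finset F, U = {R : X | ∀ x ∈ s, x ∈ (R : Subring F)}}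

/-- The patch topology on a collection `X` of subrings of `F`: generated by the
quasicompact Zariski-open sets together with their complements. -/
def patchTop (X : Set (Subring F)) : TopologicalSpace X :=
  TopologicalSpace.generateFrom
    ({U | @IsOpen _ (zariskiTop X) U ∧ @IsCompact _ (zariskiTop X) U} ∪
      {V | ∃ U, @IsOpen _ (zariskiTop X) U ∧ @IsCompact _ (zariskiTop X) U ∧ V = Uᶜ})

/-- `R` is residually algebraic over `D`: the residue field extension
`D/m_D → R/m_R` is algebraic, i.e. each element of `R` satisfies, modulo the
maximal ideal of `R`, a monic polynomial with coefficients in `D`. -/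
def ResiduallyAlgebraic (D R : Subring F) : Prop :=
  ∀ x ∈ R, ∃ p : Polynomial F, p.Monic ∧ (∀ i, p.coeff i ∈ D) ∧ MemMaxIdeal R (p.eval x)

/-- `R` is integrally closed in `F`: every element of `F` integral over `R` lies in `R`. -/
def IntegrallyClosedIn (R : Subring F) : Prop :=
  ∀ x : F, (∃ p : Polynomial F, p.Monic ∧ (∀ i, p.coeff i ∈ R) ∧ p.eval x = 0) → x ∈ R

/-- The localization of the subring `A` of `F` at the prime ideal `P`, viewed as the
subring of `F` generated by the fractions `a/b` with `a, b ∈ A`, `b ∉ P`. -/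
def localizationSubring (A : Subring F) (P : Ideal A) : Subring F :=
  Subring.closure {z : F | ∃ a b : A, b ∉ P ∧ z = (a : F) * (b : F)⁻¹}

/-- The ring `D[x₁/xᵢ, …, xₙ/xᵢ]`. -/
def modelChart (D : Subring F) {n : ℕ} (x : Fin n → F) (i : Fin n) : Subring F :=
  Subring.closure ((D : Set F) ∪ {y | ∃ j, y = x j * (x i)⁻¹})

/-- `X` is the projective model of `F/D` defined by some nonzero elements
`x₀, …, xₙ` of `F`: the set of all localizations of the rings
`D[x₀/xᵢ, …, xₙ/xᵢ]` at their prime ideals. -/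
def IsProjModel (D : Subring F) (X : Set (Subring F)) : Prop :=
  ∃ (n : ℕ) (x : Fin (n + 1) → F), (∀ i, x i ≠ 0) ∧
    X = {R | ∃ (i : Fin (n + 1)) (P : Ideal (modelChart D x i)),
          P.IsPrime ∧ R = localizationSubring (modelChart D x i) P}

/-- `X(Z)`: the members of the projective model `X` dominated by some valuation ring
in `Z`. -/
def modelImage (X Z : Set (Subring F)) : Set (Subring F) :=
  {α ∈ X | ∃ V ∈ Z, Dominates V α}

/-- `A(Y)`: the intersection of a collection `Y` of subrings of `F`, as a subset of `F`. -/
def ringsInter (Y : Set (Subring F)) : Set F :=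
  ⋂ R ∈ Y, (R : Set F)

/-- The basic Zariski-open set of members of `X` that contain `s`. -/
def zariskiBasic (X : Set (Subring F)) (s : Finset F) : Set X :=
  {R : X | ∀ y ∈ s, y ∈ (R : Subring F)}

theorem isTopologicalBasis_zariskiBasic (X : Set (Subring F)) :
    @TopologicalSpace.IsTopologicalBasis _ (zariskiTop X) (Set.range (zariskiBasic X)) := by
  classical
  let := zariskiTop X
  refine ⟨?_, ?_, ?_⟩
  · rintro _ ⟨s, rfl⟩ _ ⟨t, rfl⟩ R ⟨hs, ht⟩
    refine ⟨_, ⟨s ∪ t, rfl⟩, fun y hy => (Finset.mem_union.1 hy).elim (hs y) (ht y), fun S hS => ?_⟩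
    exact ⟨fun y hy => hS y (Finset.mem_union_left _ hy),
      fun y hy => hS y (Finset.mem_union_right _ hy)⟩
  · refine Set.eq_univ_of_forall fun R => ⟨_, ⟨∅, rfl⟩, fun y hy => ?_⟩
    simp at hy
  · change TopologicalSpace.generateFrom _ = TopologicalSpace.generateFrom _
    congr 1
    ext U
    exact exists_congr fun s => eq_comm

theorem isOpen_zariskiBasic (X : Set (Subring F)) (s : Finset F) :
    @IsOpen _ (zariskiTop X) (zariskiBasic X s) :=
  let := zariskiTop X
  (isTopologicalBasis_zariskiBasic X).isOpen ⟨s, rfl⟩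

theorem zariskiBasic_singleton_mem_nhds {X : Set (Subring F)} {R : X} {y : F} (hy : y ∈ R.1) :
    zariskiBasic X {y} ∈ @nhds _ (zariskiTop X) R :=
  let := zariskiTop X
  (isOpen_zariskiBasic X {y}).mem_nhds fun z hz => by rwa [Finset.mem_singleton.1 hz]

/-- A Zariski-open set is stable under passing to larger rings. -/
theorem mem_of_le_of_isOpen_zariskiTop {X : Set (Subring F)} {O : Set X}
    (hO : @IsOpen _ (zariskiTop X) O) {R S : X} (hRS : R.1 ≤ S.1) (hR : R ∈ O) : S ∈ O := by
  let := zariskiTop X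
  obtain ⟨_, ⟨s, rfl⟩, hs, hsO⟩ :=
    (isTopologicalBasis_zariskiBasic X).exists_subset_of_mem_open hR hO
  exact hsO fun y hy => hRS (hs y hy)

/-- The limit of an ultrafilter on `Zar_F(D)`. -/
def ultrafilterLim {D : Subring F} (u : Ultrafilter (zarSet D)) : Subring F where
  carrier := {y | ∀ᶠ V in (u : Filter (zarSet D)), y ∈ V.1}
  mul_mem' := fun ha hb => by filter_upwards [ha, hb] with V h h' using V.1.mul_mem h h'
  one_mem' := Filter.Eventually.of_forall fun V => V.1.one_mem
  add_mem' := fun ha hb => by filter_upwards [ha, hb] with V h h' using V.1.add_mem h h'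
  zero_mem' := Filter.Eventually.of_forall fun V => V.1.zero_mem
  neg_mem' := fun ha => by filter_upwards [ha] with V h using V.1.neg_mem h

theorem mem_ultrafilterLim {D : Subring F} {u : Ultrafilter (zarSet D)} {y : F} :
    y ∈ ultrafilterLim u ↔ ∀ᶠ V in (u : Filter (zarSet D)), y ∈ V.1 := Iff.rfl

theorem ultrafilterLim_mem_zarSet {D : Subring F} (u : Ultrafilter (zarSet D)) :
    ultrafilterLim u ∈ zarSet D := by
  refine ⟨fun x hx => ?_, fun x hx => Filter.Eventually.of_forall fun V => V.2.2 hx⟩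
  simp only [mem_ultrafilterLim]
  rw [← Ultrafilter.eventually_or]
  exact Filter.Eventually.of_forall fun V => V.2.1 x hx

theorem le_nhds_zariskiTop {D : Subring F} (u : Ultrafilter (zarSet D)) :
    (u : Filter (zarSet D)) ≤
      @nhds _ (zariskiTop (zarSet D)) ⟨ultrafilterLim u, ultrafilterLim_mem_zarSet u⟩ := by
  let := zariskiTop (zarSet D)
  rw [(isTopologicalBasis_zariskiBasic (zarSet D)).nhds_hasBasis.ge_iff]
  rintro _ ⟨⟨s, rfl⟩, hs⟩
  exact (Filter.eventually_all_finset s).2 fun y hy => mem_ultrafilterLim.1 (hs y hy)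

theorem mem_of_ultrafilterLim_mem {D : Subring F} (u : Ultrafilter (zarSet D)) {O : Set (zarSet D)}
    (hO : @IsOpen _ (zariskiTop (zarSet D)) O)
    (hu : ⟨ultrafilterLim u, ultrafilterLim_mem_zarSet u⟩ ∈ O) : O ∈ u :=
  let := zariskiTop (zarSet D)
  le_nhds_zariskiTop u (hO.mem_nhds hu)

theorem isCompact_zariskiBasic (D : Subring F) (s : Finset F) :
    @IsCompact _ (zariskiTop (zarSet D)) (zariskiBasic (zarSet D) s) := by
  let := zariskiTop (zarSet D)
  rw [isCompact_iff_ultrafilter_le_nhds]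
  intro u hu
  refine ⟨⟨ultrafilterLim u, ultrafilterLim_mem_zarSet u⟩, fun y hy => ?_, le_nhds_zariskiTop u⟩
  rw [mem_ultrafilterLim]
  filter_upwards [Filter.le_principal_iff.1 hu] with V hV using hV y hy

theorem compactSpace_patchTop (D : Subring F) :
    @CompactSpace _ (patchTop (zarSet D)) := by
  let := patchTop (zarSet D)
  refine ⟨isCompact_iff_ultrafilter_le_nhds.2 fun u _ =>
    ⟨⟨ultrafilterLim u, ultrafilterLim_mem_zarSet u⟩, trivial, ?_⟩⟩
  refine (TopologicalSpace.tendsto_nhds_generateFrom_iff (m := id)).2 ?_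
  rintro O (⟨hO, -⟩ | ⟨O, hO, hOc, rfl⟩) hmem
  · exact mem_of_ultrafilterLim_mem u hO hmem
  · refine Ultrafilter.compl_mem_iff_notMem.2 fun hOu => hmem ?_
    obtain ⟨V, hV, hle⟩ := (@isCompact_iff_ultrafilter_le_nhds _ (zariskiTop _) _).1 hOc u
      (Filter.le_principal_iff.2 hOu)
    refine mem_of_le_of_isOpen_zariskiTop hO (fun y hy => ?_) hV
    have := hle (zariskiBasic_singleton_mem_nhds hy)
    exact Filter.mem_of_superset this fun W hW => hW y (Finset.mem_singleton_self y)

theorem memMaxIdeal_iff {R : Subring F} {x : F} :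
    MemMaxIdeal R x ↔ x ∈ R ∧ (x ≠ 0 → x⁻¹ ∉ R) := by
  rw [MemMaxIdeal, ← exists_prop]
  refine exists_congr fun h => ?_
  rw [isUnit_iff_exists_inv]
  constructor
  · intro hu hx hinv
    exact hu ⟨⟨_, hinv⟩, Subtype.ext (mul_inv_cancel₀ hx)⟩
  · rintro hx ⟨y, hy⟩
    have hy' : x * y = 1 := congrArg Subtype.val hy
    have hx0 : x ≠ 0 := left_ne_zero_of_mul_eq_one hy'
    exact hx hx0 (by rw [inv_eq_of_mul_eq_one_right hy']; exact y.2)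

theorem dominates_iff {R S : Subring F} :
    Dominates R S ↔ S ≤ R ∧ ∀ x ∈ S, x⁻¹ ∈ R → x⁻¹ ∈ S := by
  refine and_congr_right fun hle => forall₂_congr fun x hx => ?_
  have hx' := hle hx
  rw [memMaxIdeal_iff, memMaxIdeal_iff]
  by_cases h0 : x = 0
  · simp [h0]
  · have := @hle x⁻¹
    tauto

theorem mem_localizationSubring {A : Subring F} {P : Ideal A} (hP : P.IsPrime) {z : F} :
    z ∈ localizationSubring A P ↔ ∃ a b : A, b ∉ P ∧ z = (a : F) * (b : F)⁻¹ := by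
  have ne : ∀ b : A, b ∉ P → (b : F) ≠ 0 := fun b hb h =>
    hb (by rw [Subtype.ext (a1 := b) (a2 := 0) h]; exact P.zero_mem)
  refine ⟨fun hz => ?_, fun hz => Subring.subset_closure hz⟩
  have h1 : (1 : A) ∉ P := (Ideal.ne_top_iff_one P).1 hP.ne_top
  induction hz using Subring.closure_induction with
  | mem z hz => exact hz
  | zero => exact ⟨0, 1, h1, by simp⟩
  | one => exact ⟨1, 1, h1, by simp⟩
  | add x y _ _ hx hy =>
    obtain ⟨a, b, hb, rfl⟩ := hx
    obtain ⟨c, e, he, rfl⟩ := hy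
    have := ne b hb
    have := ne e he
    refine ⟨a * e + c * b, b * e, fun h => (hP.mem_or_mem h).elim hb he, ?_⟩
    push_cast
    field_simp
  | neg x _ hx =>
    obtain ⟨a, b, hb, rfl⟩ := hx
    exact ⟨-a, b, hb, by simp⟩
  | mul x y _ _ hx hy =>
    obtain ⟨a, b, hb, rfl⟩ := hx
    obtain ⟨c, e, he, rfl⟩ := hy
    refine ⟨a * c, b * e, fun h => (hP.mem_or_mem h).elim hb he, ?_⟩
    push_cast
    rw [mul_inv]
    ring

theorem le_localizationSubring {A : Subring F} {P : Ideal A} (hP : P.IsPrime) :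
    A ≤ localizationSubring A P := fun a ha =>
  (mem_localizationSubring hP).2
    ⟨⟨a, ha⟩, 1, (Ideal.ne_top_iff_one P).1 hP.ne_top, by simp⟩

theorem inv_mem_localizationSubring {A : Subring F} {P : Ideal A} (hP : P.IsPrime) {b : A}
    (hb : b ∉ P) : (b : F)⁻¹ ∈ localizationSubring A P :=
  (mem_localizationSubring hP).2 ⟨1, b, hb, by simp⟩

theorem isLocalRing_localizationSubring {A : Subring F} {P : Ideal A} (hP : P.IsPrime) :
    IsLocalRing (localizationSubring A P) := by
  have unit : ∀ z : localizationSubring A P, ∀ a b : A, a ∉ P → b ∉ P →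
      (z : F) = (a : F) * (b : F)⁻¹ → IsUnit z := by
    intro z a b ha hb hz
    have ne : ∀ b : A, b ∉ P → (b : F) ≠ 0 := fun b hb h =>
      hb (by rw [Subtype.ext (a1 := b) (a2 := 0) h]; exact P.zero_mem)
    refine isUnit_iff_exists_inv.2
      ⟨⟨(b : F) * (a : F)⁻¹, (mem_localizationSubring hP).2 ⟨b, a, ha, rfl⟩⟩, Subtype.ext ?_⟩
    have := ne a ha
    have := ne b hb
    push_cast
    rw [hz]
    field_simp
  refine IsLocalRing.of_isUnit_or_isUnit_one_sub_self fun z => ?_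
  obtain ⟨a, b, hb, hz⟩ := (mem_localizationSubring hP).1 z.2
  by_cases ha : a ∈ P
  · refine Or.inr (unit _ (b - a) b (fun h => hb ?_) hb ?_)
    · simpa using P.add_mem h ha
    · have : (b : F) ≠ 0 := fun h =>
        hb (by rw [Subtype.ext (a1 := b) (a2 := 0) h]; exact P.zero_mem)
      push_cast
      rw [hz]
      field_simp
  · exact Or.inl (unit z a b ha hb hz)

/-- A valuation ring containing a local ring `R` specializes to one dominating `R`. -/
theorem exists_valSubring_le_dominates {R V : Subring F} [IsLocalRing R] (hV : IsValSubring V)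
    (hRV : R ≤ V) : ∃ W, IsValSubring W ∧ W ≤ V ∧ Dominates W R := by
  let V' : ValuationSubring F := ⟨V, fun x => by
    by_cases hx : x = 0
    · exact Or.inl (hx ▸ V.zero_mem)
    · exact hV x hx⟩
  let v := V'.valuation
  have hv : ∀ x, x ∈ V ↔ v x ≤ 1 := fun x => (V'.valuation_le_one_iff x).symm
  have hvR : ∀ x ∈ R, v x ≤ 1 := fun x hx => (hv x).1 (hRV hx)
  have le_one : ∀ z a, a ∈ R → v (z - a) < 1 → v z ≤ 1 := fun z a ha h => by
    rw [← sub_add_cancel z a]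
    exact v.map_add_le h.le (hvR a ha)
  have mul_sub : ∀ z w a b, a ∈ R → v w ≤ 1 → v (z - a) < 1 → v (w - b) < 1 →
      v (z * w - a * b) < 1 := fun z w a b ha hw hza hwb => by
    rw [show z * w - a * b = (z - a) * w + a * (w - b) by ring]
    refine v.map_add_lt ?_ ?_ <;> rw [map_mul]
    · exact mul_lt_one_of_nonneg_of_lt_one_left zero_le hza hw
    · exact mul_lt_one_of_nonneg_of_lt_one_right (hvR a ha) zero_le hwb
  have add_sub : ∀ z w a b, v (z - a) < 1 → v (w - b) < 1 → v (z + w - (a + b)) < 1 :=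
    fun z w a b hza hwb => by
      rw [add_sub_add_comm]
      exact v.map_add_lt hza hwb
  let B : Subring F :=
    { carrier := {z | ∃ a ∈ R, v (z - a) < 1}
      mul_mem' := by
        rintro z w ⟨a, ha, hza⟩ ⟨b, hb, hwb⟩
        exact ⟨a * b, R.mul_mem ha hb, mul_sub z w a b ha (le_one w b hb hwb) hza hwb⟩
      one_mem' := ⟨1, R.one_mem, by simp⟩
      add_mem' := by
        rintro z w ⟨a, ha, hza⟩ ⟨b, hb, hwb⟩
        exact ⟨a + b, R.add_mem ha hb, add_sub z w a b hza hwb⟩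
      zero_mem' := ⟨0, R.zero_mem, by simp⟩
      neg_mem' := by
        rintro z ⟨a, ha, hza⟩
        refine ⟨-a, R.neg_mem ha, ?_⟩
        rwa [← neg_sub', v.map_neg] }
  let I : Ideal B :=
    { carrier := {z | ∃ a : R, a ∈ IsLocalRing.maximalIdeal R ∧ v (z - a) < 1}
      add_mem' := by
        rintro z w ⟨a, ha, hza⟩ ⟨b, hb, hwb⟩
        exact ⟨a + b, Ideal.add_mem _ ha hb, add_sub z w a b hza hwb⟩
      zero_mem' := ⟨0, Ideal.zero_mem _, by simp⟩
      smul_mem' := by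
        rintro ⟨z, a, ha, hza⟩ w ⟨b, hb, hwb⟩
        exact ⟨⟨a, ha⟩ * b, Ideal.mul_mem_left _ _ hb,
          mul_sub z w a b ha (le_one w b b.2 hwb) hza hwb⟩ }
  have hI : I ≠ ⊤ := by
    rw [Ideal.ne_top_iff_one]
    rintro ⟨a, ha, h1⟩
    obtain ⟨c, hc⟩ := isUnit_iff_exists_inv.1
      ((IsLocalRing.isUnit_or_isUnit_one_sub_self a).resolve_left ha)
    have hc' : (1 - (a : F)) * c = 1 := congrArg Subtype.val hc
    have : v ((1 - (a : F)) * c) < 1 := by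
      rw [map_mul]
      exact mul_lt_one_of_nonneg_of_lt_one_left zero_le h1 (hvR c c.2)
    rw [hc', map_one] at this
    exact this.false
  obtain ⟨W, hBW, hIW⟩ := Ideal.image_subset_nonunits_valuationSubring I hI
  have notMem_inv : ∀ z : F, (∃ a : R, a ∈ IsLocalRing.maximalIdeal R ∧ v (z - a) < 1) →
      z ≠ 0 → z⁻¹ ∉ W := by
    intro z hz hz0 hinv
    have hzB : z ∈ B := by
      obtain ⟨a, -, h⟩ := hz
      exact ⟨a, a.2, h⟩
    have hzW : z ∈ W.nonunits := hIW ⟨⟨z, hzB⟩, hz, rfl⟩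
    rw [ValuationSubring.mem_nonunits_iff] at hzW
    have hi := (W.valuation_le_one_iff _).2 hinv
    have := mul_lt_one_of_nonneg_of_lt_one_left zero_le hzW hi
    rw [← map_mul, mul_inv_cancel₀ hz0, map_one] at this
    exact this.false
  refine ⟨W.toSubring, fun x _ => W.mem_or_inv_mem x, fun y hy => ?_, dominates_iff.2
    ⟨fun x hx => hBW ⟨x, hx, by simp⟩, fun x hx hxW => ?_⟩⟩
  · by_contra hyV
    have hlt : 1 < v y := lt_of_not_ge fun h => hyV ((hv y).2 h)
    have hy0 : y ≠ 0 := fun h => hyV (h ▸ V.zero_mem)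
    refine notMem_inv y⁻¹ ⟨0, Ideal.zero_mem _, ?_⟩ (inv_ne_zero hy0) (by rwa [inv_inv])
    rw [ZeroMemClass.coe_zero, sub_zero, map_inv₀]
    exact inv_lt_one_of_one_lt₀ hlt
  · by_contra hxR
    have hx0 : x ≠ 0 := by
      rintro rfl
      exact hxR (by simp)
    refine notMem_inv x ⟨⟨x, hx⟩, fun hu => ?_, by simp⟩ hx0 hxW
    exact (memMaxIdeal_iff.2 ⟨hx, fun _ => hxR⟩).2 hu

theorem le_modelChart (D : Subring F) {n : ℕ} (x : Fin n → F) (i : Fin n) :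
    D ≤ modelChart D x i := fun _ hy => Subring.subset_closure (Or.inl hy)

theorem div_mem_modelChart (D : Subring F) {n : ℕ} (x : Fin n → F) (i j : Fin n) :
    x j * (x i)⁻¹ ∈ modelChart D x i := Subring.subset_closure (Or.inr ⟨j, rfl⟩)

theorem modelChart_le {D R : Subring F} {n : ℕ} {x : Fin n → F} {i : Fin n} (hD : D ≤ R)
    (h : ∀ j, x j * (x i)⁻¹ ∈ R) : modelChart D x i ≤ R := by
  refine Subring.closure_le.2 ?_
  rintro y (hy | ⟨j, rfl⟩)
  exacts [hD hy, h j]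

theorem IsProjModel.exists_chart {D : Subring F} {X : Set (Subring F)} (hX : IsProjModel D X) :
    ∃ (n : ℕ) (x : Fin (n + 1) → F), (∀ R ∈ X, ∃ (i : Fin (n + 1))
        (P : Ideal (modelChart D x i)), P.IsPrime ∧ R = localizationSubring (modelChart D x i) P) ∧
      ∀ V, ∀ R ∈ X, Dominates V R → ∀ i, modelChart D x i ≤ V → modelChart D x i ≤ R := by
  obtain ⟨n, x, hx, rfl⟩ := hX
  refine ⟨n, x, fun R hR => hR, ?_⟩
  rintro V R ⟨k, Q, hQ, rfl⟩ hdom i hi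
  obtain ⟨hle, hinv⟩ := dominates_iff.1 hdom
  have hk := le_localizationSubring hQ
  have hki : x k * (x i)⁻¹ ∈ localizationSubring (modelChart D x k) Q := by
    have := hinv _ (hk (div_mem_modelChart D x k i))
    rw [mul_inv, inv_inv, mul_comm] at this
    exact this (hi (div_mem_modelChart D x i k))
  refine modelChart_le ((le_modelChart D x k).trans hk) fun j => ?_
  have := Subring.mul_mem _ (hk (div_mem_modelChart D x k j)) hki
  rwa [mul_assoc, inv_mul_cancel_left₀ (hx k)] at this

theorem IsProjModel.isLocalRing {D : Subring F} {X : Set (Subring F)} (hX : IsProjModel D X)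
    {R : Subring F} (hR : R ∈ X) : IsLocalRing R := by
  obtain ⟨n, x, -, rfl⟩ := hX
  obtain ⟨i, P, hP, rfl⟩ := hR
  exact isLocalRing_localizationSubring hP

theorem IsProjModel.le {D : Subring F} {X : Set (Subring F)} (hX : IsProjModel D X)
    {R : Subring F} (hR : R ∈ X) : D ≤ R := by
  obtain ⟨n, x, -, rfl⟩ := hX
  obtain ⟨i, P, hP, rfl⟩ := hR
  exact (le_modelChart D x i).trans (le_localizationSubring hP)

/-- The member of `X` dominated by `V` is the largest member of `X` contained in `V`. -/
theorem IsProjModel.le_of_dominates {D : Subring F} {X : Set (Subring F)} (hX : IsProjModel D X)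
    {R S V : Subring F} (hR : R ∈ X) (hS : S ∈ X) (hRV : R ≤ V) (hVS : Dominates V S) :
    R ≤ S := by
  obtain ⟨n, x, hloc, hdom⟩ := hX.exists_chart
  obtain ⟨i, P, hP, rfl⟩ := hloc R hR
  have hi := hdom V S hS hVS i ((le_localizationSubring hP).trans hRV)
  intro z hz
  obtain ⟨a, b, hb, rfl⟩ := (mem_localizationSubring hP).1 hz
  exact S.mul_mem (hi a.2) ((dominates_iff.1 hVS).2 b (hi b.2)
    (hRV (inv_mem_localizationSubring hP hb)))

/-- A membership condition on members of a projective model `X` is locally implied by one that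
holds for a valuation ring `V` exactly when it holds for the member of `X` dominated by `V`. -/
theorem IsProjModel.exists_finset {D : Subring F} {X : Set (Subring F)} (hX : IsProjModel D X)
    {R : Subring F} (hR : R ∈ X) {y : F} (hy : y ∈ R) :
    ∃ t : Finset F, (∀ V S, S ∈ X → Dominates V S → (∀ z ∈ t, z ∈ V) → ∀ z ∈ t, z ∈ S) ∧
      (∀ z ∈ t, z ∈ R) ∧ ∀ S ∈ X, (∀ z ∈ t, z ∈ S) → y ∈ S := by
  classical
  obtain ⟨n, x, hloc, hdom⟩ := hX.exists_chart
  obtain ⟨i, P, hP, rfl⟩ := hloc R hR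
  obtain ⟨a, b, hb, rfl⟩ := (mem_localizationSubring hP).1 hy
  refine ⟨insert (b : F)⁻¹ (Finset.univ.image fun j => x j * (x i)⁻¹), ?_, ?_, ?_⟩ <;>
    simp only [Finset.mem_insert, Finset.mem_image, Finset.mem_univ, true_and, forall_eq_or_imp,
      forall_exists_index, forall_apply_eq_imp_iff]
  · rintro V S hS hVS ⟨hbV, hV⟩
    have hi := hdom V S hS hVS i (modelChart_le ((hX.le hS).trans hVS.1) hV)
    exact ⟨(dominates_iff.1 hVS).2 b (hi b.2) hbV, fun j => hi (div_mem_modelChart D x i j)⟩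
  · exact ⟨inv_mem_localizationSubring hP hb,
      fun j => le_localizationSubring hP (div_mem_modelChart D x i j)⟩
  · rintro S hS ⟨hbS, hi⟩
    exact S.mul_mem (modelChart_le (hX.le hS) hi a.2) hbS

/-- Zariski-open sets of a projective model `X` are covered by basic ones whose preimages
under the domination map are basic. -/
theorem IsProjModel.exists_zariskiBasic {D : Subring F} {X : Set (Subring F)}
    (hX : IsProjModel D X) (d : zarSet D → X) (hd : ∀ V : zarSet D, Dominates V.1 (d V).1)
    {O : Set X} (hO : @IsOpen _ (zariskiTop X) O) {R : X} (hR : R ∈ O) :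
    ∃ t : Finset F, d ⁻¹' zariskiBasic X t = zariskiBasic (zarSet D) t ∧
      R ∈ zariskiBasic X t ∧ zariskiBasic X t ⊆ O := by
  classical
  let := zariskiTop X
  obtain ⟨_, ⟨s, rfl⟩, hs, hsO⟩ :=
    (isTopologicalBasis_zariskiBasic X).exists_subset_of_mem_open hR hO
  have key := fun y : s => hX.exists_finset R.2 (hs y y.2)
  choose t hgood htR htS using key
  refine ⟨Finset.univ.biUnion t, ?_, ?_, fun S hS => hsO fun y hy => ?_⟩
  · ext V
    refine ⟨fun h z hz => (hd V).1 (h z hz), fun h z hz => ?_⟩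
    obtain ⟨y, hy, hzy⟩ := Finset.mem_biUnion.1 hz
    exact hgood y V.1 (d V).1 (d V).2 (hd V)
      (fun w hw => h w (Finset.mem_biUnion.2 ⟨y, hy, hw⟩)) z hzy
  · intro z hz
    obtain ⟨y, hy, hzy⟩ := Finset.mem_biUnion.1 hz
    exact htR y z hzy
  · exact htS ⟨y, hy⟩ S.1 S.2 fun z hz =>
      hS z (Finset.mem_biUnion.2 ⟨⟨y, hy⟩, Finset.mem_univ _, hz⟩)

section DominationMap

variable {D : Subring F} {X : Set (Subring F)} {d : zarSet D → X}

theorem IsProjModel.exists_le_map_eq (hX : IsProjModel D X)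
    (hd : ∀ V : zarSet D, Dominates V.1 (d V).1) (R : X) {V : Subring F} (hV : IsValSubring V)
    (hRV : R.1 ≤ V) : ∃ W : zarSet D, W.1 ≤ V ∧ d W = R := by
  have := hX.isLocalRing R.2
  obtain ⟨W, hW, hWV, hWR⟩ := exists_valSubring_le_dominates hV hRV
  refine ⟨⟨W, hW, (hX.le R.2).trans hWR.1⟩, hWV, Subtype.ext (le_antisymm ?_ ?_)⟩
  · exact hX.le_of_dominates (d _).2 R.2 (hd ⟨W, _⟩).1 hWR
  · exact hX.le_of_dominates R.2 (d _).2 hWR.1 (hd ⟨W, _⟩)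

theorem IsProjModel.surjective (hX : IsProjModel D X)
    (hd : ∀ V : zarSet D, Dominates V.1 (d V).1) : Function.Surjective d := fun R =>
  let ⟨W, _, hW⟩ := hX.exists_le_map_eq hd R (V := ⊤) (fun _ _ => Or.inl trivial) le_top
  ⟨W, hW⟩

theorem IsProjModel.continuous_zariskiTop (hX : IsProjModel D X)
    (hd : ∀ V : zarSet D, Dominates V.1 (d V).1) :
    @Continuous _ _ (zariskiTop (zarSet D)) (zariskiTop X) d := by
  let := zariskiTop X
  let := zariskiTop (zarSet D)
  refine ⟨fun O hO => isOpen_iff_forall_mem_open.2 fun V hV => ?_⟩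
  obtain ⟨t, hpre, hmem, hsub⟩ := hX.exists_zariskiBasic d hd hO hV
  exact ⟨zariskiBasic _ t, hpre ▸ Set.preimage_mono hsub, isOpen_zariskiBasic _ t, hpre ▸ hmem⟩

theorem IsProjModel.isClosedMap_zariskiTop (hX : IsProjModel D X)
    (hd : ∀ V : zarSet D, Dominates V.1 (d V).1) :
    @IsClosedMap _ _ (zariskiTop (zarSet D)) (zariskiTop X) d := by
  let := zariskiTop X
  let := zariskiTop (zarSet D)
  intro C hC
  refine isClosed_of_closure_subset fun R hR => ?_
  have hne : (Filter.comap d (nhds R) ⊓ Filter.principal C).NeBot := by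
    rw [← Filter.map_neBot_iff d, Filter.push_pull', Filter.map_principal]
    exact mem_closure_iff_clusterPt.1 hR
  obtain ⟨u, hu⟩ := Ultrafilter.exists_le (Filter.comap d (nhds R) ⊓ Filter.principal C)
  have hVC : (⟨ultrafilterLim u, ultrafilterLim_mem_zarSet u⟩ : zarSet D) ∈ C :=
    hC.mem_of_tendsto (f := id) (le_nhds_zariskiTop u)
      (Filter.le_principal_iff.1 (hu.trans inf_le_right))
  have hRV : R.1 ≤ ultrafilterLim u := fun y hy => by
    have := (hu.trans inf_le_left) 
      (Filter.preimage_mem_comap (zariskiBasic_singleton_mem_nhds hy))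
    exact Filter.mem_of_superset this fun V hV => (hd V).1 (hV y (Finset.mem_singleton_self y))
  obtain ⟨W, hWV, hWR⟩ := hX.exists_le_map_eq hd R (ultrafilterLim_mem_zarSet u).1 hRV
  refine ⟨W, ?_, hWR⟩
  by_contra hWC
  exact mem_of_le_of_isOpen_zariskiTop hC.isOpen_compl (S := ⟨_, _⟩) hWV hWC hVC

theorem IsProjModel.continuous_patchTop (hX : IsProjModel D X)
    (hd : ∀ V : zarSet D, Dominates V.1 (d V).1) :
    @Continuous _ _ (patchTop (zarSet D)) (patchTop X) d := by
  have key : ∀ O : Set X, @IsOpen _ (zariskiTop X) O → @IsCompact _ (zariskiTop X) O →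
      @IsOpen _ (zariskiTop (zarSet D)) (d ⁻¹' O) ∧
        @IsCompact _ (zariskiTop (zarSet D)) (d ⁻¹' O) := by
    let := zariskiTop X
    let := zariskiTop (zarSet D)
    refine fun O hO hOc => ⟨hO.preimage (hX.continuous_zariskiTop hd), ?_⟩
    refine isCompact_iff_ultrafilter_le_nhds.2 fun u hu => ?_
    obtain ⟨R, hRO, hR⟩ := isCompact_iff_ultrafilter_le_nhds.1 hOc (u.map d)
      (Filter.le_principal_iff.2 (Ultrafilter.mem_map.2 (Filter.le_principal_iff.1 hu)))
    obtain ⟨t, hpre, hmem, hsub⟩ := hX.exists_zariskiBasic d hd hO hRO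
    have htu : d ⁻¹' zariskiBasic X t ∈ u := hR ((isOpen_zariskiBasic X t).mem_nhds hmem)
    rw [hpre] at htu
    obtain ⟨V, hV, huV⟩ := isCompact_iff_ultrafilter_le_nhds.1 (isCompact_zariskiBasic D t) u
      (Filter.le_principal_iff.2 htu)
    rw [← hpre] at hV
    exact ⟨V, hsub hV, huV⟩
  let := patchTop (zarSet D)
  refine continuous_generateFrom_iff.2 ?_
  rintro O (⟨hO, hOc⟩ | ⟨O, hO, hOc, rfl⟩)
  · exact TopologicalSpace.isOpen_generateFrom_of_mem (Or.inl (key O hO hOc))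
  · exact TopologicalSpace.isOpen_generateFrom_of_mem
      (Or.inr ⟨d ⁻¹' O, (key O hO hOc).1, (key O hO hOc).2, rfl⟩)

theorem IsProjModel.t2Space_patchTop (hX : IsProjModel D X)
    (hd : ∀ V : zarSet D, Dominates V.1 (d V).1) : @T2Space _ (patchTop X) := by
  have key : ∀ R S : X, ¬ R.1 ≤ S.1 → ∃ U : Set X,
      @IsOpen _ (patchTop X) U ∧ @IsOpen _ (patchTop X) Uᶜ ∧ R ∈ U ∧ S ∉ U := by
    intro R S hRS
    obtain ⟨y, hyR, hyS⟩ := SetLike.not_le_iff_exists.1 hRS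
    obtain ⟨t, hpre, hmem, hsub⟩ := hX.exists_zariskiBasic d hd (isOpen_zariskiBasic X {y})
      (R := R) (fun z hz => by rwa [Finset.mem_singleton.1 hz])
    have hc : @IsCompact _ (zariskiTop X) (zariskiBasic X t) := by
      let := zariskiTop X
      let := zariskiTop (zarSet D)
      rw [← Set.image_preimage_eq (zariskiBasic X t) (hX.surjective hd), hpre]
      exact (isCompact_zariskiBasic D t).image (hX.continuous_zariskiTop hd)
    have ho := isOpen_zariskiBasic X t
    exact ⟨_, TopologicalSpace.isOpen_generateFrom_of_mem (Or.inl ⟨ho, hc⟩),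
      TopologicalSpace.isOpen_generateFrom_of_mem (Or.inr ⟨_, ho, hc, rfl⟩), hmem,
      fun h => hyS (hsub h y (Finset.mem_singleton_self y))⟩
  let := patchTop X
  refine ⟨fun R S hne => ?_⟩
  by_cases hRS : R.1 ≤ S.1
  · obtain ⟨U, hU, hUc, hS, hR⟩ := key S R fun h => hne (Subtype.ext (le_antisymm hRS h))
    exact ⟨Uᶜ, U, hUc, hU, hR, hS, disjoint_compl_left⟩
  · obtain ⟨U, hU, hUc, hR, hS⟩ := key R S hRS
    exact ⟨U, Uᶜ, hU, hUc, hR, hS, disjoint_compl_right⟩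

end DominationMap

/-- For a projective model `X` of `F/D`, the domination map
`d_X : Zar_F(D) → X`, sending a valuation ring to the unique member of `X` it
dominates, is surjective, continuous and closed for the Zariski topologies, and
continuous and closed for the patch topologies. -/
theorem statement3 (D : Subring F) (X : Set (Subring F)) (hX : IsProjModel D X)
    (d : ↥(zarSet D) → ↥X) (hd : ∀ V : ↥(zarSet D), Dominates V.1 (d V).1) :
    Function.Surjective d ∧
    @Continuous _ _ (zariskiTop (zarSet D)) (zariskiTop X) d ∧
    @IsClosedMap _ _ (zariskiTop (zarSet D)) (zariskiTop X) d ∧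
    @Continuous _ _ (patchTop (zarSet D)) (patchTop X) d ∧
    @IsClosedMap _ _ (patchTop (zarSet D)) (patchTop X) d := by
  refine ⟨hX.surjective hd, hX.continuous_zariskiTop hd, hX.isClosedMap_zariskiTop hd,
    hX.continuous_patchTop hd, ?_⟩
  let := patchTop X
  let := patchTop (zarSet D)
  have := compactSpace_patchTop D
  have := hX.t2Space_patchTop hd
  exact (hX.continuous_patchTop hd).isClosedMap
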